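/- Let k be an integer with k ≥ 0. With the convention a(0,k) = 1 and a(m,k) = 0 for m < 0, the counts a(n,k) satisfy the recurrence a(n,k) = a(n−1,k) + a(n−2,k) − a(n−3,k) + a(n−3−k,k) for every integer n ≥ 3. -/

import Mathlib

/-- A composition of `n`: a list of positive integers summing to `n`. -/
def IsComposition (n : ℤ) (l : List ℕ) : Prop :=
  (∀ x ∈ l, 0 < x) ∧ (l.sum : ℤ) = n

/-- Generalized Arndt condition with integer shift `k`:
`c_{2i-1} > c_{2i} + k` for every pair of consecutive parts. -/
def ArndtCondK (k : ℤ) (l : List ℕ) : Prop :=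
  ∀ i : ℕ, 2 * i + 1 < l.length →
    (l.getD (2 * i + 1) 0 : ℤ) + k < (l.getD (2 * i) 0 : ℤ)

theorem arndtCondK_cons_cons (k : ℤ) (x y : ℕ) (r : List ℕ) :
    ArndtCondK k (x :: y :: r) ↔ (y : ℤ) + k < x ∧ ArndtCondK k r := by
  constructor
  · intro h
    refine ⟨by simpa using h 0 (by simp), fun i hi => ?_⟩
    simpa [Nat.mul_add, List.getD_cons_succ] using
      h (i + 1) (by simp only [List.length_cons]; omega)
  · rintro ⟨h0, h⟩ (_ | i) hi
    · simpa using h0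
    · simpa [Nat.mul_add, List.getD_cons_succ] using
        h i (by simp only [List.length_cons] at hi; omega)

/-- The compositions of `n` satisfying the Arndt condition with shift `k`. -/
def arndtSet (k n : ℤ) : Set (List ℕ) := {l | IsComposition n l ∧ ArndtCondK k l}

/-- Members of `arndtSet k n` with at least two parts, with the first two parts split off. -/
def arndtPairSet (k n : ℤ) : Set (ℕ × ℕ × List ℕ) :=
  {t | 0 < t.2.1 ∧ (t.2.1 : ℤ) + k < t.1 ∧ t.2.2 ∈ arndtSet k (n - t.1 - t.2.1)}

/-- Members of `arndtSet k n` whose second part is `1`, with that part omitted and the first part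
split off. -/
def arndtOneSet (k n : ℤ) : Set (ℕ × List ℕ) :=
  {t | 1 + k < t.1 ∧ t.2 ∈ arndtSet k (n - t.1 - 1)}

theorem cons_cons_mem_arndtSet {k : ℤ} (hk : 0 ≤ k) (n : ℤ) (x y : ℕ) (r : List ℕ) :
    x :: y :: r ∈ arndtSet k n ↔ (x, y, r) ∈ arndtPairSet k n := by
  simp only [arndtSet, arndtPairSet, IsComposition, Set.mem_ofPred_eq, arndtCondK_cons_cons,
    List.forall_mem_cons, List.sum_cons]
  push_cast
  constructor
  · rintro ⟨⟨⟨hx, hy, hr⟩, hs⟩, hxy, hc⟩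
    exact ⟨hy, hxy, ⟨hr, by omega⟩, hc⟩
  · rintro ⟨hy, hxy, ⟨hr, hs⟩, hc⟩
    exact ⟨⟨⟨by omega, hy, hr⟩, by omega⟩, hxy, hc⟩

theorem finite_arndtSet (k n : ℤ) : (arndtSet k n).Finite := by
  refine (Set.finite_range (fun c : Composition n.toNat => c.blocks)).subset ?_
  rintro l ⟨⟨hp, hs⟩, -⟩
  exact ⟨⟨l, fun {i} hi => hp i hi, by omega⟩, rfl⟩

theorem finite_arndtPairSet {k : ℤ} (hk : 0 ≤ k) (n : ℤ) : (arndtPairSet k n).Finite := by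
  refine Set.Finite.subset ((finite_arndtSet k n).preimage
    (f := fun t : ℕ × ℕ × List ℕ => t.1 :: t.2.1 :: t.2.2) ?_) ?_
  · rintro ⟨x, y, r⟩ - ⟨x', y', r'⟩ - h
    simpa using h
  · rintro ⟨x, y, r⟩ h
    exact (cons_cons_mem_arndtSet hk n x y r).2 h

theorem finite_arndtOneSet {k : ℤ} (hk : 0 ≤ k) (n : ℤ) : (arndtOneSet k n).Finite := by
  refine Set.Finite.subset ((finite_arndtPairSet hk n).preimage
    (f := fun t : ℕ × List ℕ => (t.1, 1, t.2)) ?_) ?_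
  · rintro ⟨x, r⟩ - ⟨x', r'⟩ - h
    simpa using h
  · rintro ⟨x, r⟩ ⟨h1, h2⟩
    exact ⟨one_pos, by simpa using h1, by simpa using h2⟩

theorem arndtSet_of_neg (k : ℤ) {n : ℤ} (hn : n < 0) : arndtSet k n = ∅ := by
  refine Set.eq_empty_of_forall_notMem ?_
  rintro l ⟨⟨-, hs⟩, -⟩
  omega

theorem ncard_arndtSet {k : ℤ} (hk : 0 ≤ k) {n : ℤ} (hn : 0 ≤ n) :
    (arndtSet k n).ncard = (arndtPairSet k n).ncard + 1 := by
  have hinj : Function.Injective (fun t : ℕ × ℕ × List ℕ => t.1 :: t.2.1 :: t.2.2) := by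
    rintro ⟨x, y, r⟩ ⟨x', y', r'⟩ h
    simpa using h
  have hset : arndtSet k n = insert (if n = 0 then [] else [n.toNat])
      ((fun t : ℕ × ℕ × List ℕ => t.1 :: t.2.1 :: t.2.2) '' arndtPairSet k n) := by
    ext l
    rcases l with _ | ⟨x, _ | ⟨y, r⟩⟩
    · split_ifs <;> simp [arndtSet, IsComposition, ArndtCondK] <;> omega
    · split_ifs <;> simp [arndtSet, IsComposition, ArndtCondK] <;> omega
    · rw [cons_cons_mem_arndtSet hk]
      split_ifs <;> simp
  rw [hset, Set.ncard_insert_of_notMem _ ((finite_arndtPairSet hk n).image _),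
    Set.ncard_image_of_injective _ hinj]
  split_ifs <;> simp

theorem ncard_arndtSet_zero {k : ℤ} (hk : 0 ≤ k) : (arndtSet k 0).ncard = 1 := by
  have h : arndtPairSet k 0 = ∅ := by
    refine Set.eq_empty_of_forall_notMem ?_
    rintro ⟨x, y, r⟩ ⟨hy, -, hr⟩
    rw [arndtSet_of_neg] at hr
    · exact hr
    · dsimp only at hy ⊢
      omega
  rw [ncard_arndtSet hk le_rfl, h, Set.ncard_empty]

theorem ncard_arndtPairSet {k : ℤ} (hk : 0 ≤ k) (n : ℤ) :
    (arndtPairSet k n).ncard = (arndtPairSet k (n - 2)).ncard + (arndtOneSet k n).ncard := by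
  have hf : Function.Injective (fun t : ℕ × ℕ × List ℕ => (t.1 + 1, t.2.1 + 1, t.2.2)) := by
    rintro ⟨x, y, r⟩ ⟨x', y', r'⟩ h
    simpa using h
  have hg : Function.Injective (fun t : ℕ × List ℕ => (t.1, 1, t.2)) := by
    rintro ⟨x, r⟩ ⟨x', r'⟩ h
    simpa using h
  have hset : arndtPairSet k n =
      (fun t : ℕ × ℕ × List ℕ => (t.1 + 1, t.2.1 + 1, t.2.2)) '' arndtPairSet k (n - 2) ∪
      (fun t : ℕ × List ℕ => (t.1, 1, t.2)) '' arndtOneSet k n := by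
    ext ⟨x, y, r⟩
    constructor
    · rintro ⟨hy, hxy, hr⟩
      dsimp only at hy hxy hr
      obtain rfl | hy1 := eq_or_ne y 1
      · exact Or.inr ⟨(x, r), ⟨by simpa using hxy, by simpa using hr⟩, rfl⟩
      · obtain ⟨y, rfl⟩ := Nat.exists_eq_add_of_lt hy
        obtain ⟨x, rfl⟩ : ∃ x', x = x' + 1 := ⟨x - 1, by omega⟩
        refine Or.inl ⟨(x, y, r), ⟨by dsimp only; omega, by dsimp only; omega, ?_⟩, by simp⟩
        convert hr using 2
        push_cast
        ring
    · rintro (⟨⟨x, y, r⟩, ⟨hy, hxy, hr⟩, h⟩ | ⟨⟨x, r⟩, ⟨hx, hr⟩, h⟩)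
      · rw [← h]
        refine ⟨by simp, by push_cast; dsimp only at hxy; omega, ?_⟩
        convert hr using 2
        push_cast
        ring
      · rw [← h]
        exact ⟨one_pos, by simpa using hx, by simpa using hr⟩
  rw [hset, Set.ncard_union_eq _ ((finite_arndtPairSet hk _).image _)
    ((finite_arndtOneSet hk _).image _), Set.ncard_image_of_injective _ hf,
    Set.ncard_image_of_injective _ hg]
  rw [Set.disjoint_left]
  rintro _ ⟨⟨x, y, r⟩, ⟨hy, -, -⟩, rfl⟩ ⟨⟨x', r'⟩, -, h⟩
  simp only [Prod.mk.injEq] at h hy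
  omega

theorem ncard_arndtOneSet {k : ℤ} (hk : 0 ≤ k) (n : ℤ) :
    (arndtOneSet k n).ncard =
      (arndtOneSet k (n - 1)).ncard + (arndtSet k (n - 3 - k)).ncard := by
  have hf : Function.Injective (fun t : ℕ × List ℕ => (t.1 + 1, t.2)) := by
    rintro ⟨x, r⟩ ⟨x', r'⟩ h
    simpa using h
  have hg : Function.Injective (fun r : List ℕ => (k.toNat + 2, r)) := by
    intro r r' h
    simpa using h
  have hset : arndtOneSet k n =
      (fun t : ℕ × List ℕ => (t.1 + 1, t.2)) '' arndtOneSet k (n - 1) ∪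
      (fun r : List ℕ => (k.toNat + 2, r)) '' arndtSet k (n - 3 - k) := by
    ext ⟨x, r⟩
    constructor
    · rintro ⟨hx, hr⟩
      dsimp only at hx hr
      obtain rfl | hx1 := eq_or_ne x (k.toNat + 2)
      · refine Or.inr ⟨r, ?_, rfl⟩
        convert hr using 2
        omega
      · obtain ⟨x, rfl⟩ : ∃ x', x = x' + 1 := ⟨x - 1, by omega⟩
        refine Or.inl ⟨(x, r), ⟨by dsimp only; omega, ?_⟩, rfl⟩
        convert hr using 2
        push_cast
        ring
    · rintro (⟨⟨x, r⟩, ⟨hx, hr⟩, h⟩ | ⟨r, hr, h⟩)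
      · rw [← h]
        refine ⟨by dsimp only at hx ⊢; omega, ?_⟩
        convert hr using 2
        push_cast
        ring
      · rw [← h]
        refine ⟨by dsimp only; omega, ?_⟩
        convert hr using 2
        dsimp only
        omega
  rw [hset, Set.ncard_union_eq _ ((finite_arndtOneSet hk _).image _)
    ((finite_arndtSet k _).image _), Set.ncard_image_of_injective _ hf,
    Set.ncard_image_of_injective _ hg]
  rw [Set.disjoint_left]
  rintro _ ⟨⟨x, r⟩, ⟨hx, -⟩, rfl⟩ ⟨r', -, h⟩
  simp only [Prod.mk.injEq] at h hx
  omega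

theorem arndt_recurrence_nonneg (k : ℤ) (hk : 0 ≤ k) (a : ℤ → ℕ)
    (ha0 : a 0 = 1) (haneg : ∀ m : ℤ, m < 0 → a m = 0)
    (hapos : ∀ m : ℤ, 0 < m →
      a m = Nat.card {l : List ℕ // IsComposition m l ∧ ArndtCondK k l}) :
    ∀ n : ℤ, 3 ≤ n →
      (a n : ℤ) = a (n - 1) + a (n - 2) - a (n - 3) + a (n - 3 - k) := by
  have ha : ∀ m, a m = (arndtSet k m).ncard := by
    intro m
    rcases lt_trichotomy m 0 with h | rfl | h
    · rw [haneg m h, arndtSet_of_neg k h, Set.ncard_empty]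
    · rw [ha0, ncard_arndtSet_zero hk]
    · exact hapos m h
  intro n hn
  have h0 := ncard_arndtSet hk (n := n) (by omega)
  have h1 := ncard_arndtSet hk (n := n - 1) (by omega)
  have h2 := ncard_arndtSet hk (n := n - 2) (by omega)
  have h3 := ncard_arndtSet hk (n := n - 3) (by omega)
  have hp := ncard_arndtPairSet hk n
  have hp' := ncard_arndtPairSet hk (n - 1)
  have ho := ncard_arndtOneSet hk n
  rw [show n - 1 - 2 = n - 3 by ring] at hp'
  simp only [ha]
  omega
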